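/- arXiv:2306.16929 — 2 statements merged into one kernel-verified Lean document; each statement's English description precedes it below -/
import Mathlib

section
/- For positive integer $c$ and integers $m,n$ with $\gcd(m,n,c)=1$, the Selberg identity reduces to $S(m,n;c)=S(mn,1;c)$. -/
open Finset

noncomputable def e (c : ℕ) (x : ℤ) : ℂ := Complex.exp (2 * Real.pi * Complex.I * x / c)

noncomputable def Kl (m n : ℤ) (c : ℕ) : ℂ :=
  ∑ a ∈ (Finset.range c).filter (fun a => Nat.Coprime a c),
    e c (m * a + n * (((a : ZMod c)⁻¹).val : ℤ))

noncomputable def Xi (k m n : ℤ) (c : ℕ) : ℂ :=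
  ∑ x ∈ Finset.range c, ∑ y ∈ Finset.range c,
    if ((x : ℤ) * y) % c = k % c then e c (m * x + n * y) else 0

/-- Some positive power of every element of a finite monoid is idempotent. -/
theorem exists_isIdempotentElem_pow_succ {M : Type*} [Monoid M] [Finite M] (x : M) :
    ∃ k : ℕ, IsIdempotentElem (x ^ (k + 1)) := by
  obtain ⟨i, j, hij, h⟩ : ∃ i j : ℕ, i < j ∧ x ^ i = x ^ j := by
    obtain ⟨i, j, hne, h⟩ := Finite.exists_ne_map_eq_of_infinite (fun k : ℕ => x ^ k)
    rcases hne.lt_or_gt with hlt | hlt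
    exacts [⟨i, j, hlt, h⟩, ⟨j, i, hlt, h.symm⟩]
  obtain ⟨d, rfl⟩ := Nat.exists_eq_add_of_lt hij
  have period : ∀ r s : ℕ, x ^ (i + s + (d + 1) * r) = x ^ (i + s) := by
    intro r s
    induction r with
    | zero => simp
    | succ r ih =>
      rw [← ih, show i + s + (d + 1) * (r + 1) = i + d + 1 + (s + (d + 1) * r) by ring, pow_add,
        ← h, ← pow_add, add_assoc i s]
  refine ⟨i + d * (i + 1), ?_⟩
  have := period (i + 1) (d * (i + 1) + 1)
  rw [IsIdempotentElem, ← pow_add]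
  convert this using 2
  · ring
  · ring

/-- Coprime elements of a finite commutative ring are separated by an idempotent `ε`: `m` is
invertible on the component of `ε`, and `n` on the complementary component. -/
theorem IsCoprime.exists_idempotent_mul_eq {R : Type*} [CommRing R] [Finite R] {m n : R}
    (h : IsCoprime m n) :
    ∃ ε p q : R, ε * ε = ε ∧ ε * (m * p) = ε ∧ (1 - ε) * (n * q) = 1 - ε := by
  obtain ⟨k, hk⟩ := exists_isIdempotentElem_pow_succ m
  obtain ⟨u, v, huv⟩ := h.pow_left (m := k + 1)
  have hpow : m ^ (k + 1) * m ^ (k + 1) = m ^ (k + 1) := hk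
  refine ⟨m ^ (k + 1), m ^ k, v, hk, ?_, ?_⟩
  · rw [← pow_succ', hpow]
  · linear_combination (1 - m ^ (k + 1)) * huv + u * hpow

/-- Over a finite commutative ring, for coprime `m` and `n`, the values of `m * u + n * u⁻¹` and
of `m * n * u + u⁻¹` on units are equidistributed. -/
theorem sum_units_mul_add_mul_inv {R A : Type*} [CommRing R] [Fintype Rˣ] [Finite R]
    [AddCommMonoid A] {m n : R} (h : IsCoprime m n) (ψ : R → A) :
    ∑ u : Rˣ, ψ (m * u + n * (u⁻¹ : Rˣ)) = ∑ u : Rˣ, ψ (m * n * u + (u⁻¹ : Rˣ)) := by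
  obtain ⟨ε, p, q, hε, hp, hq⟩ := h.exists_idempotent_mul_eq
  let σ : Rˣ → Rˣ := fun u =>
    { val := ε * (p * (u⁻¹ : Rˣ)) + (1 - ε) * (q * u)
      inv := ε * (m * u) + (1 - ε) * (n * (u⁻¹ : Rˣ))
      val_inv := by
        have hu := u.mul_inv
        grind
      inv_val := by
        have hu := u.mul_inv
        grind }
  have hσ : Function.Injective σ := by
    intro u v huv
    have h₁ : ε * (p * (u⁻¹ : Rˣ)) + (1 - ε) * (q * u) =
      ε * (p * (v⁻¹ : Rˣ)) + (1 - ε) * (q * v) := congrArg Units.val huv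
    have h₂ : ε * (m * u) + (1 - ε) * (n * (u⁻¹ : Rˣ)) =
      ε * (m * v) + (1 - ε) * (n * (v⁻¹ : Rˣ)) := congrArg (fun w : Rˣ => (w⁻¹ : Rˣ).val) huv
    have h₃ : ε * (u : R) = ε * v := by
      linear_combination (ε * p) * h₂ + (v - u : R) * hp +
        (n * p * (u⁻¹ : Rˣ) - n * p * (v⁻¹ : Rˣ) - m * p * u + m * p * v) * hε
    have h₄ : (1 - ε) * (u : R) = (1 - ε) * v := by
      linear_combination ((1 - ε) * n) * h₁ + (v - u : R) * hq +
        (n * p * (u⁻¹ : Rˣ) - n * p * (v⁻¹ : Rˣ) - n * q * u + n * q * v) * hε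
    exact Units.ext (by linear_combination h₃ + h₄)
  refine Fintype.sum_bijective σ (Finite.injective_iff_bijective.mp hσ) _ _ fun u => ?_
  congr 1
  change _ = m * n * (ε * (p * (u⁻¹ : Rˣ)) + (1 - ε) * (q * u)) +
    (ε * (m * u) + (1 - ε) * (n * (u⁻¹ : Rˣ)))
  linear_combination (-n * (u⁻¹ : Rˣ)) * hp + (-m * u) * hq

theorem e_eq_stdAddChar (c : ℕ) [NeZero c] (x : ℤ) : e c x = ZMod.stdAddChar (x : ZMod c) := by
  rw [ZMod.stdAddChar_coe, e]

theorem Kl_eq_sum_units (m n : ℤ) (c : ℕ) [NeZero c] :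
    Kl m n c = ∑ u : (ZMod c)ˣ,
      ZMod.stdAddChar (m * (u : ZMod c) + n * (u⁻¹ : (ZMod c)ˣ) : ZMod c) := by
  refine Finset.sum_bij' (fun a ha => ZMod.unitOfCoprime a (Finset.mem_filter.mp ha).2)
    (fun u _ => (u : ZMod c).val) (by simp) ?_ ?_ ?_ ?_
  · intro u _
    simpa [ZMod.val_lt] using ZMod.val_coe_unit_coprime u
  · intro a ha
    simpa using Nat.mod_eq_of_lt (Finset.mem_range.mp (Finset.mem_filter.mp ha).1)
  · intro u _
    ext
    simp
  · intro a ha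
    rw [e_eq_stdAddChar, ← ZMod.inv_coe_unit]
    simp

theorem ZMod.isCoprime_intCast_of_gcd_eq_one {c : ℕ} {m n : ℤ}
    (h : Int.gcd m (Int.gcd n c) = 1) : IsCoprime (m : ZMod c) (n : ZMod c) := by
  obtain ⟨u, v, huv⟩ := Int.isCoprime_iff_gcd_eq_one.mpr h
  refine ⟨u, v * Int.gcdA n c, ?_⟩
  have := congrArg (Int.cast : ℤ → ZMod c) huv
  rw [Int.gcd_eq_gcd_ab] at this
  push_cast [ZMod.natCast_self] at this
  linear_combination this

theorem selberg_coprime (c : ℕ) (hc : 0 < c) (m n : ℤ)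
    (h : Int.gcd m (Int.gcd n c) = 1) : Kl m n c = Kl (m * n) 1 c := by
  have : NeZero c := ⟨hc.ne'⟩
  rw [Kl_eq_sum_units, Kl_eq_sum_units,
    sum_units_mul_add_mul_inv (ZMod.isCoprime_intCast_of_gcd_eq_one h)]
  simp
end

section
/- For positive integer $c$ and integers $m,n$, one has the intermediate identity $S(m,n;c) = \sum_{d \mid c} \sum_{a \bmod c/d,\ (a,c/d)=1} \sum_{y \bmod c,\ ady \equiv -m \bmod c} e((ny-ad)/c)$. -/
open Finset

theorem sum_range_natCast_zmod {M : Type*} [AddCommMonoid M] (c : ℕ) [NeZero c]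
    (f : ZMod c → M) : ∑ x ∈ range c, f (x : ZMod c) = ∑ x : ZMod c, f x := by
  refine Finset.sum_bij' (fun x _ => (x : ZMod c)) (fun x _ => x.val) ?_ ?_ ?_ ?_ ?_
  · simp
  · intro x _
    exact mem_range.2 x.val_lt
  · intro x hx
    exact ZMod.val_cast_of_lt (mem_range.1 hx)
  · intro x _
    exact ZMod.natCast_zmod_val x
  · simp

/-- Grouping the residues modulo `c` by their greatest common divisor with `c`. -/
theorem sum_divisors_sum_coprime {M : Type*} [AddCommMonoid M] {c : ℕ} (hc : 0 < c)
    (f : ℕ → M) :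
    ∑ d ∈ c.divisors, ∑ a ∈ (range (c / d)).filter (fun a => Nat.Coprime a (c / d)), f (a * d) =
      ∑ x ∈ range c, f x := by
  rw [← Finset.sum_fiberwise_of_maps_to (s := range c) (t := c.divisors)
    (g := fun x => Nat.gcd x c) (fun x _ => Nat.mem_divisors.2 ⟨Nat.gcd_dvd_right x c, hc.ne'⟩)]
  refine Finset.sum_congr rfl fun d hd => ?_
  obtain ⟨k, rfl⟩ := Nat.dvd_of_mem_divisors hd
  have hd0 : 0 < d := Nat.pos_of_mul_pos_right hc
  rw [Nat.mul_div_cancel_left k hd0]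
  refine Finset.sum_bij' (fun a _ => a * d) (fun x _ => x / d) ?_ ?_ ?_ ?_ ?_
  · intro a ha
    simp only [mem_filter, mem_range] at ha ⊢
    refine ⟨by rw [mul_comm d k]; exact Nat.mul_lt_mul_of_pos_right ha.1 hd0, ?_⟩
    rw [mul_comm a d, Nat.gcd_mul_left, ha.2, mul_one]
  · intro x hx
    simp only [mem_filter, mem_range] at hx ⊢
    obtain ⟨a, rfl⟩ : d ∣ x := hx.2 ▸ Nat.gcd_dvd_left x (d * k)
    rw [Nat.mul_div_cancel_left a hd0]
    refine ⟨lt_of_mul_lt_mul_left hx.1 hd0.le, ?_⟩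
    have h := hx.2
    rw [Nat.gcd_mul_left] at h
    exact Nat.eq_of_mul_eq_mul_left hd0 (h.trans (mul_one d).symm)
  · intro a _
    exact Nat.mul_div_cancel a hd0
  · intro x hx
    simp only [mem_filter] at hx
    exact Nat.div_mul_cancel (hx.2 ▸ Nat.gcd_dvd_left x (d * k))
  · simp

theorem Kl_eq_sum_zmod (c : ℕ) [NeZero c] (m n : ℤ) :
    Kl m n c = ∑ k : ZMod c, ∑ y : ZMod c,
      if k * y = 1 then ZMod.stdAddChar (m * k + n * y : ZMod c) else 0 := by
  rw [Kl, Finset.sum_filter, ← sum_range_natCast_zmod]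
  refine Finset.sum_congr rfl fun a _ => ?_
  split_ifs with h
  · have hinv : (a : ZMod c) * (a : ZMod c)⁻¹ = 1 := ZMod.coe_mul_inv_eq_one a h
    rw [Finset.sum_eq_single (a : ZMod c)⁻¹, if_pos hinv, e_eq_stdAddChar]
    · simp
    · intro y _ hy
      refine if_neg fun hay => hy ?_
      calc y = (a * (a : ZMod c)⁻¹) * y := by rw [hinv, one_mul]
        _ = (a : ZMod c)⁻¹ * (a * y) := by ring
        _ = (a : ZMod c)⁻¹ := by rw [hay, mul_one]
    · simp
  · refine (Finset.sum_eq_zero fun y _ => if_neg fun hay => h ?_).symm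
    exact (ZMod.isUnit_iff_coprime a c).1 (IsUnit.of_mul_eq_one y hay)

/-- Both sides arise from `∑ k, x, y, ψ (k * (x * y + m) + n * y - x)`: summing over `x` first
detects `k * y = 1`, summing over `k` first detects `x * y = -m`. -/
theorem sum_mul_eq_one_eq_sum_mul_eq_neg {R : Type*} [CommRing R] [Fintype R] [DecidableEq R]
    {ψ : AddChar R ℂ} (hψ : ψ.IsPrimitive) (m n : R) :
    (∑ k : R, ∑ y : R, if k * y = 1 then ψ (m * k + n * y) else 0) =
      ∑ x : R, ∑ y : R, if x * y = -m then ψ (n * y - x) else 0 := by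
  have hcard : (Fintype.card R : ℂ) ≠ 0 := Nat.cast_ne_zero.2 Fintype.card_ne_zero
  refine mul_left_cancel₀ hcard ?_
  have hleft (k y : R) : ∑ x : R, ψ (k * (x * y + m) + n * y - x) =
      Fintype.card R * if k * y = 1 then ψ (m * k + n * y) else 0 := by
    have (x : R) : ψ (k * (x * y + m) + n * y - x) =
        ψ (m * k + n * y) * ψ (x * (k * y - 1)) := by
      rw [← AddChar.map_add_eq_mul]
      ring_nf
    simp_rw [this]
    rw [← Finset.mul_sum, AddChar.sum_mulShift _ hψ]
    simp only [sub_eq_zero]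
    split_ifs <;> simp [mul_comm]
  have hright (x y : R) : ∑ k : R, ψ (k * (x * y + m) + n * y - x) =
      Fintype.card R * if x * y = -m then ψ (n * y - x) else 0 := by
    have (k : R) : ψ (k * (x * y + m) + n * y - x) =
        ψ (n * y - x) * ψ (k * (x * y + m)) := by
      rw [← AddChar.map_add_eq_mul]
      ring_nf
    simp_rw [this]
    rw [← Finset.mul_sum, AddChar.sum_mulShift _ hψ]
    simp only [add_eq_zero_iff_eq_neg]
    split_ifs <;> simp [mul_comm]
  simp_rw [Finset.mul_sum, ← hleft, ← hright]
  calc _ = ∑ k : R, ∑ x : R, ∑ y : R, ψ (k * (x * y + m) + n * y - x) :=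
        Finset.sum_congr rfl fun k _ => Finset.sum_comm
    _ = ∑ x : R, ∑ k : R, ∑ y : R, ψ (k * (x * y + m) + n * y - x) := Finset.sum_comm
    _ = _ := Finset.sum_congr rfl fun x _ => Finset.sum_comm

theorem kloosterman_intermediate (c : ℕ) (hc : 0 < c) (m n : ℤ) :
    Kl m n c = ∑ d ∈ c.divisors,
      ∑ a ∈ (Finset.range (c / d)).filter (fun a => Nat.Coprime a (c / d)),
        ∑ y ∈ Finset.range c,
          if ((a : ℤ) * d * y) % c = (-m) % c then e c (n * y - a * d) else 0 := by
  have : NeZero c := ⟨hc.ne'⟩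
  have hgroup := sum_divisors_sum_coprime hc fun x => ∑ y ∈ range c,
    if ((x : ℤ) * y) % c = (-m) % c then e c (n * y - x) else 0
  simp only [Nat.cast_mul] at hgroup
  rw [hgroup, Kl_eq_sum_zmod,
    sum_mul_eq_one_eq_sum_mul_eq_neg (ZMod.isPrimitive_stdAddChar c) (m : ZMod c) n,
    ← sum_range_natCast_zmod]
  refine Finset.sum_congr rfl fun x _ => ?_
  rw [← sum_range_natCast_zmod]
  refine Finset.sum_congr rfl fun y _ => ?_
  have hiff : ((x : ℤ) * y) % c = (-m) % c ↔ (x : ZMod c) * y = -m := by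
    have := ZMod.intCast_eq_intCast_iff ((x : ℤ) * y) (-m) c
    push_cast at this
    exact this.symm
  simp only [hiff, e_eq_stdAddChar]
  push_cast
  rfl
end
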